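/- Let d ≥ 1, let s ∈ (0,∞)^d, and let β > 0. Define ψ(x,y) = (β/2)‖x‖² + β⟨s, y⟩ + (d/2) ln(1 − ‖x‖² − ‖y‖²) on the open Euclidean unit ball B_{2d}(0,1) ⊂ ℝ^d × ℝ^d. If either ‖s‖ ≥ 1, or ‖s‖ < 1 and β ≤ d/(1 − ‖s‖²), then ψ has a unique global maximizing point on B_{2d}(0,1), namely (0, r₂* · s/‖s‖) with r₂* = sqrt(1 + (d/(2β‖s‖))²) − d/(2β‖s‖). -/

import Mathlib

open MeasureTheory Filter Topology

noncomputable def ip {d : ℕ} (x y : Fin d → ℝ) : ℝ := ∑ j, x j * y j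

noncomputable def sampleMean (d : ℕ) (h : ℕ → Fin d → ℝ) (n : ℕ) : Fin d → ℝ :=
  fun j => (∑ i ∈ Finset.range n, h i j) / n

noncomputable def sampleStd (d : ℕ) (h : ℕ → Fin d → ℝ) (n : ℕ) : Fin d → ℝ :=
  fun j => Real.sqrt ((∑ i ∈ Finset.range n, (h i j) ^ 2) / n - (sampleMean d h n j) ^ 2)

/-- Membership in the open unit ball `B_{2d}(0,1) ⊂ ℝ^d × ℝ^d`. -/
def inBall (d : ℕ) (x y : Fin d → ℝ) : Prop := ip x x + ip y y < 1

def ballSet (d : ℕ) : Set ((Fin d → ℝ) × (Fin d → ℝ)) := {p | inBall d p.1 p.2}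

/-- The exponential tilting function with mean vector `m` and standard deviation vector `s`. -/
noncomputable def psi (d : ℕ) (β : ℝ) (m s : Fin d → ℝ) (x y : Fin d → ℝ) : ℝ :=
  β / 2 * ip x x + β * ip m x + β * ip s y + (d : ℝ) / 2 * Real.log (1 - ip x x - ip y y)
theorem ip_self_nonneg {d : ℕ} (x : Fin d → ℝ) : 0 ≤ ip x x :=
  Finset.sum_nonneg fun j _ => mul_self_nonneg (x j)

theorem ip_self_eq_zero {d : ℕ} {x : Fin d → ℝ} (h : ip x x = 0) : x = 0 := by
  funext j
  have := (Finset.sum_eq_zero_iff_of_nonneg fun j _ => mul_self_nonneg (x j)).1 h j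
    (Finset.mem_univ j)
  simpa using this

theorem ip_zero_left {d : ℕ} (x : Fin d → ℝ) : ip 0 x = 0 := by
  simp [ip]

theorem ip_mul_right {d : ℕ} (a : ℝ) (x y : Fin d → ℝ) :
    ip x (fun j => a * y j) = a * ip x y := by
  simp only [ip, Finset.mul_sum]
  exact Finset.sum_congr rfl fun j _ => by ring

theorem ip_mul_mul {d : ℕ} (a : ℝ) (x : Fin d → ℝ) :
    ip (fun j => a * x j) (fun j => a * x j) = a ^ 2 * ip x x := by
  simp only [ip, Finset.mul_sum]
  exact Finset.sum_congr rfl fun j _ => by ring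

theorem ip_sub_mul_self {d : ℕ} (a : ℝ) (x y : Fin d → ℝ) :
    ip (fun j => y j - a * x j) (fun j => y j - a * x j)
      = ip y y - 2 * a * ip x y + a ^ 2 * ip x x := by
  simp only [ip, Finset.mul_sum, ← Finset.sum_sub_distrib, ← Finset.sum_add_distrib]
  exact Finset.sum_congr rfl fun j _ => by ring

/-- A point of the ball where `psi` is at least its value at `(0, r • s / ‖s‖)` is that point,
when `r ≤ ‖s‖` satisfies the critical equation `β ‖s‖ (1 - r²) = d r`. -/
theorem eq_of_psi_le {d : ℕ} (hd : 1 ≤ d) {s : Fin d → ℝ} {β n r : ℝ} (hβ : 0 < β)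
    (hn : 0 < n) (hns : ip s s = n ^ 2) (hr : 0 < r) (hr1 : r < 1) (hrn : r ≤ n)
    (hcrit : β * n * (1 - r ^ 2) = d * r) {x y : Fin d → ℝ} (hxy : inBall d x y)
    (hle : psi d β 0 s 0 (fun j => r * (s j / n)) ≤ psi d β 0 s x y) :
    x = 0 ∧ y = fun j => r * (s j / n) := by
  have hq : (fun j => r * (s j / n)) = fun j => r / n * s j := by
    funext j
    ring
  have hd0 : (0 : ℝ) < d := by exact_mod_cast hd
  have hX := ip_self_nonneg x
  have hD := ip_self_nonneg (fun j => y j - r / n * s j)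
  have hDe := ip_sub_mul_self (r / n) s y
  have hw : 0 < 1 - ip x x - ip y y := by
    unfold inBall at hxy
    linarith
  have hw0 : 0 < 1 - r ^ 2 := by nlinarith
  have hrn2 : (r / n) ^ 2 * ip s s = r ^ 2 := by
    rw [hns]
    field_simp
  have hrs : r / n * ip s s = r * n := by
    rw [hns]
    field_simp
  rw [hq] at hle ⊢
  simp only [psi, ip_zero_left, ip_mul_mul, hrn2] at hle
  simp only [ip_mul_right, hrs] at hle
  rw [hrn2] at hDe
  set X := ip x x
  set Y := ip y y
  set Z := ip s y
  set D := ip (fun j => y j - r / n * s j) (fun j => y j - r / n * s j)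
  have hkey : d / 2 * ((1 - X - Y) / (1 - r ^ 2) - 1) = β * n / (2 * r) * (r ^ 2 - X - Y) := by
    have hdr : (d : ℝ) = β * n * (1 - r ^ 2) / r := by
      rw [hcrit]
      field_simp
    rw [hdr]
    field_simp
    ring
  have hid : β / 2 * X + β * Z - β * (r * n) + β * n / (2 * r) * (r ^ 2 - X - Y)
      = -(β / (2 * r) * ((n - r) * X)) - β * n / (2 * r) * D := by
    rw [hDe]
    field_simp
    ring
  have hlog : Real.log ((1 - X - Y) / (1 - r ^ 2))
      = Real.log (1 - X - Y) - Real.log (1 - r ^ 2) := Real.log_div hw.ne' hw0.ne'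
  have hA : 0 ≤ β / (2 * r) * ((n - r) * X) :=
    mul_nonneg (by positivity) (mul_nonneg (by linarith) hX)
  have hB : 0 ≤ β * n / (2 * r) * D := mul_nonneg (by positivity) hD
  have hsub : (d : ℝ) / 2 * ((1 - X - Y) / (1 - r ^ 2) - 1)
      ≤ d / 2 * Real.log ((1 - X - Y) / (1 - r ^ 2)) - β * n / (2 * r) * D := by
    rw [hlog, mul_sub]
    simp only [sub_zero] at hle
    linarith
  have hwe : (1 - X - Y) / (1 - r ^ 2) = 1 := by
    by_contra hne
    have h1 := mul_lt_mul_of_pos_left (Real.log_lt_sub_one_of_pos (div_pos hw hw0) hne)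
      (half_pos hd0)
    linarith
  rw [hwe, Real.log_one] at hsub
  have hD0 : D = 0 := by
    have hc : 0 < β * n / (2 * r) := by positivity
    nlinarith
  have hy : y = fun j => r / n * s j := by
    funext j
    have := congrFun (ip_self_eq_zero hD0) j
    simpa [sub_eq_zero] using this
  have hY : Y = r ^ 2 := by
    simp only [Y, hy, ip_mul_mul, hrn2]
  rw [div_eq_one_iff_eq hw0.ne', hY] at hwe
  exact ⟨ip_self_eq_zero (by linarith : X = 0), hy⟩

/-- In the non-ferromagnetic regime (m = 0 and either ‖s‖ ≥ 1, or ‖s‖ < 1 and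
β ≤ d/(1-‖s‖²)), the limiting exponential tilting function has the unique global
maximizing point (0, r₂*·s/‖s‖) with r₂* = sqrt(1 + (d/(2β‖s‖))²) − d/(2β‖s‖). -/
theorem stmt2 (d : ℕ) (hd : 1 ≤ d) (s : Fin d → ℝ) (hspos : ∀ j, 0 < s j)
    (β : ℝ) (hβ : 0 < β)
    (hcase : 1 ≤ ip s s ∨ (ip s s < 1 ∧ β ≤ (d : ℝ) / (1 - ip s s))) :
    letI ns : ℝ := Real.sqrt (ip s s)
    letI r2 : ℝ := Real.sqrt (1 + ((d : ℝ) / (2 * β * ns)) ^ 2) - (d : ℝ) / (2 * β * ns)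
    letI q : (Fin d → ℝ) × (Fin d → ℝ) := (0, fun j => r2 * (s j / ns))
    inBall d q.1 q.2 ∧
      (∀ x y : Fin d → ℝ, inBall d x y → psi d β 0 s x y ≤ psi d β 0 s q.1 q.2) ∧
      ∀ p : (Fin d → ℝ) × (Fin d → ℝ), inBall d p.1 p.2 →
        (∀ x y : Fin d → ℝ, inBall d x y → psi d β 0 s x y ≤ psi d β 0 s p.1 p.2) →
        p = q := by
  set n : ℝ := Real.sqrt (ip s s)
  set r : ℝ := Real.sqrt (1 + ((d : ℝ) / (2 * β * n)) ^ 2) - (d : ℝ) / (2 * β * n)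
  set q : (Fin d → ℝ) × (Fin d → ℝ) := (0, fun j => r * (s j / n))
  have hd0 : (0 : ℝ) < d := by exact_mod_cast hd
  have hss : 0 < ip s s :=
    Finset.sum_pos (fun j _ => mul_pos (hspos j) (hspos j)) ⟨⟨0, hd⟩, Finset.mem_univ _⟩
  have hn : 0 < n := Real.sqrt_pos.2 hss
  have hns : ip s s = n ^ 2 := (Real.sq_sqrt hss.le).symm
  have hc : 0 < (d : ℝ) / (2 * β * n) := by positivity
  have hcd : β * n * (2 * (d / (2 * β * n))) = d := by field_simp
  have hquad : r ^ 2 + 2 * (d / (2 * β * n)) * r = 1 := by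
    have := Real.sq_sqrt (by positivity : (0 : ℝ) ≤ 1 + ((d : ℝ) / (2 * β * n)) ^ 2)
    simp only [r]
    linear_combination this
  have hr : 0 < r := sub_pos.2 (Real.lt_sqrt_of_sq_lt (by linarith))
  have hr1 : r < 1 := by nlinarith [mul_pos hc hr]
  have hcrit : β * n * (1 - r ^ 2) = d * r := by
    linear_combination r * hcd - β * n * hquad
  have hrn : r ≤ n := by
    rcases hcase with h | ⟨h, hb⟩
    · nlinarith
    · rw [le_div_iff₀ (by linarith), hns] at hb
      by_contra! hlt
      have h1 : β * n * (1 - r ^ 2) < β * n * (1 - n ^ 2) :=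
        mul_lt_mul_of_pos_left (by nlinarith) (mul_pos hβ hn)
      have h2 := mul_le_mul_of_nonneg_left hb hn.le
      have h3 := mul_lt_mul_of_pos_left hlt hd0
      linarith
  have huniq : ∀ x y : Fin d → ℝ, inBall d x y → psi d β 0 s q.1 q.2 ≤ psi d β 0 s x y →
      x = 0 ∧ y = fun j => r * (s j / n) := fun x y hxy hle =>
    eq_of_psi_le hd hβ hn hns hr hr1 hrn hcrit hxy hle
  have hqball : inBall d q.1 q.2 := by
    have hq : q.2 = fun j => r / n * s j := by
      funext j
      simp only [q]
      ring
    have hrn2 : (r / n) ^ 2 * n ^ 2 = r ^ 2 := by field_simp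
    rw [inBall, hq, ip_mul_mul, hns, hrn2, show q.1 = 0 from rfl, ip_zero_left]
    nlinarith
  refine ⟨hqball, fun x y hxy => ?_, fun p hp hmax => ?_⟩
  · by_contra! hlt
    obtain ⟨rfl, rfl⟩ := huniq x y hxy hlt.le
    exact lt_irrefl _ hlt
  · obtain ⟨h1, h2⟩ := huniq p.1 p.2 hp (hmax q.1 q.2 hqball)
    exact Prod.ext h1 h2
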